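/- arXiv:2311.16255 — 2 statements merged into one kernel-verified Lean document; each statement's English description precedes it below -/
import Mathlib

section
/- There is an absolute constant C > 0 such that for every α ∈ [0, π/2), each j ∈ {0, 1, 2}, every t ∈ ℝ and every τ > 0, the function h(t;τ) = cosh(α·t)·2·√τ·K_{it}(2πτ) is j times differentiable in τ and satisfies |∂^j/∂τ^j h(t;τ)| ≤ C·(1 + |log τ|)·τ^{1/2}·((1+|t|)/τ)^j·e^{−(π/2 − α)|t|}. -/
open MeasureTheory Real Set

noncomputable section

/-- The modified Bessel function of imaginary order:
    K_{it}(x) = ∫₀^∞ e^{−x cosh u} cos(tu) du. -/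
def Kit (t x : ℝ) : ℝ :=
  ∫ u in Set.Ioi (0 : ℝ), Real.exp (-x * Real.cosh u) * Real.cos (t * u)

/-- Moments `∫ cosh^n u e^{-x cosh u} cos (t u)`. -/
def Mom (n : ℕ) (t x : ℝ) : ℝ :=
  ∫ u in Set.Ioi (0 : ℝ), Real.cosh u ^ n * (Real.exp (-x * Real.cosh u) * Real.cos (t * u))

theorem Mom_zero (t x : ℝ) : Mom 0 t x = Kit t x := by simp [Mom, Kit]

theorem pow_le_exp_half {y : ℝ} (hy : 0 ≤ y) {n : ℕ} (hn : n ≤ 2) :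
    y ^ n ≤ 8 * Real.exp (y / 2) := by
  have h1 := Real.quadratic_le_exp_of_nonneg (x := y / 2) (by positivity)
  interval_cases n <;> nlinarith [sq_nonneg y]

theorem le_cosh' (u : ℝ) : u ≤ Real.cosh u := by
  rw [Real.cosh_eq]
  have h1 := Real.quadratic_le_exp_of_nonneg (x := |u|) (abs_nonneg u)
  have h2 := Real.add_one_le_exp (-u)
  rcases le_total 0 u with h | h
  · rw [abs_of_nonneg h] at h1
    have := Real.exp_pos (-u)
    nlinarith [sq_nonneg (u - 1)]
  · have := Real.exp_pos (-u)
    have := Real.exp_pos u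
    linarith

theorem cosh_pow_exp_le {x : ℝ} (hx : 0 < x) {n : ℕ} (hn : n ≤ 2) (u : ℝ) :
    (x * Real.cosh u) ^ n * Real.exp (-x * Real.cosh u) ≤ 8 * Real.exp (-(x / 2) * Real.cosh u) := by
  have hc := Real.cosh_pos u
  have h := pow_le_exp_half (y := x * Real.cosh u) (by positivity) hn
  calc _ ≤ 8 * Real.exp (x * Real.cosh u / 2) * Real.exp (-x * Real.cosh u) := by gcongr
    _ = _ := by rw [mul_assoc, ← Real.exp_add]; ring_nf

theorem cosh_pow_exp_le' {x : ℝ} (hx : 0 < x) {n : ℕ} (hn : n ≤ 2) (u : ℝ) :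
    Real.cosh u ^ n * Real.exp (-x * Real.cosh u) ≤ 8 / x ^ n * Real.exp (-(x / 2) * u) := by
  have hc := Real.cosh_pos u
  have h := cosh_pow_exp_le hx hn u
  have h2 : Real.exp (-(x / 2) * Real.cosh u) ≤ Real.exp (-(x / 2) * u) := by
    apply Real.exp_le_exp.2
    nlinarith [le_cosh' u]
  rw [mul_pow] at h
  rw [div_mul_eq_mul_div, le_div_iff₀ (by positivity)]
  nlinarith

theorem integrable_dom {x : ℝ} (hx : 0 < x) {n : ℕ} (hn : n ≤ 2) :
    IntegrableOn (fun u => Real.cosh u ^ n * Real.exp (-x * Real.cosh u)) (Ioi 0) := by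
  have h : IntegrableOn (fun u => 8 / x ^ n * Real.exp (-(x / 2) * u)) (Ioi 0) :=
    (exp_neg_integrableOn_Ioi 0 (b := x / 2) (by positivity)).const_mul _
  refine Integrable.mono' h ?_ ?_
  · apply Continuous.aestronglyMeasurable
    have := Real.continuous_cosh
    fun_prop
  · refine Filter.Eventually.of_forall fun u => ?_
    have hc := Real.cosh_pos u
    rw [Real.norm_of_nonneg (by positivity)]
    exact cosh_pow_exp_le' hx hn u

theorem integrable_of_dom {x : ℝ} (hx : 0 < x) {n : ℕ} (hn : n ≤ 2) {f : ℝ → ℝ} (hf : Continuous f)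
    (h : ∀ u, |f u| ≤ Real.cosh u ^ n * Real.exp (-x * Real.cosh u)) :
    IntegrableOn f (Ioi 0) :=
  Integrable.mono' (integrable_dom hx hn) hf.aestronglyMeasurable
    (Filter.Eventually.of_forall fun u => h u)

theorem abs_Mom_integrand_le (n : ℕ) (t x u : ℝ) :
    |Real.cosh u ^ n * (Real.exp (-x * Real.cosh u) * Real.cos (t * u))| ≤
      Real.cosh u ^ n * Real.exp (-x * Real.cosh u) := by
  have hc := Real.cosh_pos u
  rw [abs_mul, abs_mul, abs_of_pos (by positivity : 0 < Real.cosh u ^ n), Real.abs_exp]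
  have := Real.abs_cos_le_one (t * u)
  have h2 := Real.exp_pos (-x * Real.cosh u)
  gcongr
  nlinarith

theorem cont_Mom_integrand (n : ℕ) (t x : ℝ) :
    Continuous fun u => Real.cosh u ^ n * (Real.exp (-x * Real.cosh u) * Real.cos (t * u)) := by
  have := Real.continuous_cosh
  fun_prop

theorem integrable_Mom {x : ℝ} (hx : 0 < x) {n : ℕ} (hn : n ≤ 2) (t : ℝ) :
    IntegrableOn (fun u => Real.cosh u ^ n * (Real.exp (-x * Real.cosh u) * Real.cos (t * u)))
      (Ioi 0) :=
  integrable_of_dom hx hn (cont_Mom_integrand n t x) (abs_Mom_integrand_le n t x)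

theorem hasDerivAt_Mom {x : ℝ} (hx : 0 < x) {n : ℕ} (hn : n ≤ 1) (t : ℝ) :
    HasDerivAt (Mom n t) (-Mom (n + 1) t x) x := by
  have key := hasDerivAt_integral_of_dominated_loc_of_deriv_le (μ := volume.restrict (Ioi (0 : ℝ)))
    (𝕜 := ℝ)
    (F := fun y u => Real.cosh u ^ n * (Real.exp (-y * Real.cosh u) * Real.cos (t * u)))
    (F' := fun y u => -(Real.cosh u ^ (n + 1) * (Real.exp (-y * Real.cosh u) * Real.cos (t * u))))
    (x₀ := x) (s := Ioi (x / 2))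
    (bound := fun u => Real.cosh u ^ (n + 1) * Real.exp (-(x / 2) * Real.cosh u))
    (Ioi_mem_nhds (by linarith))
    (Filter.Eventually.of_forall fun y => (cont_Mom_integrand n t y).aestronglyMeasurable)
    (integrable_Mom hx (by omega) t)
    (cont_Mom_integrand (n + 1) t x).neg.aestronglyMeasurable
    (Filter.Eventually.of_forall fun u y hy => ?_)
    (integrable_dom (by linarith) (by omega))
    (Filter.Eventually.of_forall fun u y hy => ?_)
  · have := key.2
    rw [integral_neg] at this
    exact this
  · have hc := Real.cosh_pos u
    rw [norm_neg, Real.norm_eq_abs]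
    refine (abs_Mom_integrand_le (n + 1) t y u).trans ?_
    have : x / 2 < y := hy
    gcongr
  · have h1 : HasDerivAt (fun y : ℝ => -y * Real.cosh u) (-1 * Real.cosh u) y :=
      ((hasDerivAt_id y).neg).mul_const _
    have h2 := ((h1.exp.mul_const (Real.cos (t * u))).const_mul (Real.cosh u ^ n))
    exact h2.congr_deriv (by ring)

theorem tendsto_exp_zero {x : ℝ} (hx : 0 < x) :
    Filter.Tendsto (fun u => 8 / x ^ 1 * Real.exp (-(x / 2) * u)) Filter.atTop (nhds 0) := by
  have h1 : Filter.Tendsto (fun u : ℝ => (x / 2) * u) Filter.atTop Filter.atTop :=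
    Filter.tendsto_id.const_mul_atTop (by positivity)
  have := (Real.tendsto_exp_neg_atTop_nhds_zero.comp h1).const_mul (8 / x ^ 1)
  simpa [Function.comp_def] using this

theorem abs_sinh_le_cosh (u : ℝ) : |Real.sinh u| ≤ Real.cosh u := by
  rw [Real.abs_sinh, ← Real.cosh_abs u]
  exact (Real.sinh_lt_cosh _).le

/-- `∫ x sinh u e^{-x cosh u} sin(tu)` -/
def Sin1 (t x : ℝ) : ℝ :=
  ∫ u in Set.Ioi (0 : ℝ), x * (Real.sinh u * (Real.exp (-x * Real.cosh u) * Real.sin (t * u)))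

theorem abs_Sin1_integrand_le (t x u : ℝ) :
    |Real.sinh u * (Real.exp (-x * Real.cosh u) * Real.sin (t * u))| ≤
      Real.cosh u ^ 1 * Real.exp (-x * Real.cosh u) := by
  have hc := Real.cosh_pos u
  rw [abs_mul, abs_mul, Real.abs_exp, pow_one]
  have := Real.abs_sin_le_one (t * u)
  have h2 := Real.exp_pos (-x * Real.cosh u)
  have := abs_sinh_le_cosh u
  gcongr
  nlinarith

theorem integrable_Sin1 {x : ℝ} (hx : 0 < x) (t : ℝ) :
    IntegrableOn (fun u => x * (Real.sinh u * (Real.exp (-x * Real.cosh u) * Real.sin (t * u))))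
      (Ioi 0) := by
  refine Integrable.const_mul (integrable_of_dom hx (n := 1) (by norm_num) ?_
    (abs_Sin1_integrand_le t x)) x
  have := Real.continuous_cosh
  have := Real.continuous_sinh
  fun_prop

theorem ibp1 {x : ℝ} (hx : 0 < x) (t : ℝ) : t * Mom 0 t x = Sin1 t x := by
  have h0 : ∫ u in Ioi (0 : ℝ), (t * (Real.cosh u ^ 0 * (Real.exp (-x * Real.cosh u) * Real.cos (t * u)))
      - x * (Real.sinh u * (Real.exp (-x * Real.cosh u) * Real.sin (t * u)))) = 0 -
        (Real.exp (-x * Real.cosh 0) * Real.sin (t * 0)) := by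
    refine integral_Ioi_of_hasDerivAt_of_tendsto'
      (f := fun u => Real.exp (-x * Real.cosh u) * Real.sin (t * u)) (fun u _ => ?_)
      (((integrable_Mom hx (by norm_num) t).const_mul t).sub (integrable_Sin1 hx t)) ?_
    · have h1 := ((Real.hasDerivAt_cosh u).const_mul (-x)).exp
      have h2 := ((hasDerivAt_id u).const_mul t).sin
      refine (h1.mul h2).congr_deriv ?_
      simp only [id, pow_zero]
      ring
    · refine squeeze_zero_norm (fun u => ?_) (tendsto_exp_zero hx)
      refine le_trans ?_ (cosh_pow_exp_le' hx (n := 1) (by norm_num) u)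
      rw [norm_mul, Real.norm_eq_abs, Real.norm_eq_abs, Real.abs_exp, pow_one]
      have := Real.abs_sin_le_one (t * u)
      have h2 := Real.exp_pos (-x * Real.cosh u)
      have := Real.one_le_cosh u
      nlinarith
  rw [integral_sub ((integrable_Mom hx (by norm_num) t).const_mul t) (integrable_Sin1 hx t),
    integral_const_mul] at h0
  simp only [mul_zero, Real.sin_zero, sub_zero] at h0
  exact sub_eq_zero.1 h0

theorem ode {x : ℝ} (hx : 0 < x) (t : ℝ) :
    x ^ 2 * Mom 2 t x - x * Mom 1 t x = (x ^ 2 - t ^ 2) * Mom 0 t x := by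
  have i0 := (integrable_Mom hx (n := 0) (by norm_num) t).const_mul (x ^ 2)
  have i1 := (integrable_Mom hx (n := 1) (by norm_num) t).const_mul x
  have i2 := (integrable_Mom hx (n := 2) (by norm_num) t).const_mul (x ^ 2)
  have i3 := (integrable_Sin1 hx t).const_mul t
  have h0 : ∫ u in Ioi (0 : ℝ), (x * (Real.cosh u ^ 1 * (Real.exp (-x * Real.cosh u) * Real.cos (t * u)))
      - x ^ 2 * (Real.cosh u ^ 2 * (Real.exp (-x * Real.cosh u) * Real.cos (t * u)))
      + x ^ 2 * (Real.cosh u ^ 0 * (Real.exp (-x * Real.cosh u) * Real.cos (t * u)))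
      - t * (x * (Real.sinh u * (Real.exp (-x * Real.cosh u) * Real.sin (t * u))))) = 0 -
        (x * Real.sinh 0 * (Real.exp (-x * Real.cosh 0) * Real.cos (t * 0))) := by
    refine integral_Ioi_of_hasDerivAt_of_tendsto'
      (f := fun u => x * Real.sinh u * (Real.exp (-x * Real.cosh u) * Real.cos (t * u))) (fun u _ => ?_)
      (((i1.sub i2).add i0).sub i3) ?_
    · have h1 := ((Real.hasDerivAt_cosh u).const_mul (-x)).exp
      have h2 := ((hasDerivAt_id u).const_mul t).cos
      have h3 := (Real.hasDerivAt_sinh u).const_mul x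
      refine (h3.mul (h1.mul h2)).congr_deriv ?_
      simp only [id, pow_zero]
      rw [Real.cosh_sq u]
      simp
      ring
    · have := (tendsto_exp_zero hx).const_mul x
      rw [mul_zero] at this
      refine squeeze_zero_norm (fun u => ?_) this
      refine le_trans ?_ (mul_le_mul_of_nonneg_left (cosh_pow_exp_le' hx (n := 1) (by norm_num) u) hx.le)
      rw [norm_mul, norm_mul, norm_mul, Real.norm_eq_abs, Real.norm_eq_abs, Real.norm_eq_abs,
        Real.norm_eq_abs, Real.abs_exp, pow_one, abs_of_pos hx, mul_assoc]
      have := Real.abs_cos_le_one (t * u)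
      have h2 := Real.exp_pos (-x * Real.cosh u)
      have := abs_sinh_le_cosh u
      gcongr
      nlinarith
  have e1 := integral_sub ((i1.sub i2).add i0) i3
  have e2 := integral_add (i1.sub i2) i0
  simp only [Pi.add_apply, Pi.sub_apply] at e1 e2
  rw [e1, e2, integral_sub i1 i2,
    integral_const_mul, integral_const_mul, integral_const_mul, integral_const_mul] at h0
  simp only [mul_zero, Real.sinh_zero, zero_mul, sub_zero] at h0
  change x * Mom 1 t x - x ^ 2 * Mom 2 t x + x ^ 2 * Mom 0 t x - t * Sin1 t x = 0 at h0
  rw [← ibp1 hx t] at h0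
  linarith

theorem J_le {x : ℝ} (hx : 0 < x) :
    ∫ u in Ioi (0 : ℝ), Real.exp (-x * Real.cosh u) ≤ |Real.log x| + 2 := by
  set L := |Real.log x| with hL
  have hL0 : 0 ≤ L := abs_nonneg _
  have hint : IntegrableOn (fun u => Real.exp (-x * Real.cosh u)) (Ioi 0) := by
    simpa using integrable_dom hx (n := 0) (by norm_num)
  rw [← Ioc_union_Ioi_eq_Ioi hL0, setIntegral_union Ioc_disjoint_Ioi_same measurableSet_Ioi
    (hint.mono_set Ioc_subset_Ioi_self) (hint.mono_set (Ioi_subset_Ioi hL0))]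
  have h1 : ∫ u in Ioc 0 L, Real.exp (-x * Real.cosh u) ≤ ∫ u in Ioc 0 L, (1 : ℝ) := by
    refine setIntegral_mono_on (hint.mono_set Ioc_subset_Ioi_self) (by simp) measurableSet_Ioc ?_
    intro u _
    rw [Real.exp_le_one_iff]
    have := Real.cosh_pos u
    nlinarith
  have h2 : ∫ u in Ioi L, Real.exp (-x * Real.cosh u) ≤
      ∫ u in Ioi L, Real.exp (L / 2) * Real.exp ((-(1 / 2)) * u) := by
    refine setIntegral_mono_on (hint.mono_set (Ioi_subset_Ioi hL0))
      ((integrableOn_exp_mul_Ioi (by norm_num) L).const_mul _) measurableSet_Ioi ?_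
    intro u _
    rw [← Real.exp_add]
    apply Real.exp_le_exp.2
    have a1 : x * Real.exp u = Real.exp (u + Real.log x) := by
      rw [Real.exp_add, Real.exp_log hx]; ring
    have a2 := Real.add_one_le_exp (u + Real.log x)
    have a3 : -Real.log x ≤ L := neg_le_abs _
    have a4 := Real.cosh_eq u
    have a5 := mul_pos hx (Real.exp_pos (-u))
    have a6 : x * Real.cosh u = (x * Real.exp u + x * Real.exp (-u)) / 2 := by rw [a4]; ring
    linarith
  rw [integral_const_mul, integral_exp_mul_Ioi (by norm_num)] at h2
  have h3 : Real.exp (L / 2) * (-Real.exp (-(1 / 2) * L) / -(1 / 2)) = 2 := by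
    have : Real.exp (L / 2) * Real.exp (-(1 / 2) * L) = 1 := by
      rw [← Real.exp_add]; ring_nf; simp
    linear_combination 2 * this
  have h4 : ∫ u in Ioc 0 L, (1 : ℝ) = L := by simp [hL0]
  linarith

theorem Mom_direct {x : ℝ} (hx : 0 < x) {n : ℕ} (hn : n ≤ 2) (t : ℝ) :
    |x ^ n * Mom n t x| ≤ 8 * Real.exp (-(x / 4)) * (|Real.log (x / 4)| + 2) := by
  have h1 : |x ^ n * Mom n t x| ≤
      ∫ u in Ioi (0 : ℝ), 8 * Real.exp (-(x / 4)) * Real.exp (-(x / 4) * Real.cosh u) := by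
    rw [Mom, ← integral_const_mul, ← Real.norm_eq_abs]
    refine norm_integral_le_of_norm_le ?_ (Filter.Eventually.of_forall fun u => ?_)
    · have := integrable_dom (x := x / 4) (by positivity) (n := 0) (by norm_num)
      simp only [pow_zero, one_mul] at this
      exact Integrable.const_mul this _
    · rw [norm_mul, Real.norm_eq_abs, Real.norm_eq_abs, abs_of_pos (by positivity)]
      have h1 := abs_Mom_integrand_le n t x u
      have h2 := cosh_pow_exp_le hx hn u
      rw [mul_pow] at h2
      have h3 : Real.exp (-(x / 2) * Real.cosh u) ≤
          Real.exp (-(x / 4)) * Real.exp (-(x / 4) * Real.cosh u) := by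
        rw [← Real.exp_add]
        apply Real.exp_le_exp.2
        nlinarith [Real.one_le_cosh u]
      calc _ ≤ x ^ n * (Real.cosh u ^ n * Real.exp (-x * Real.cosh u)) := by gcongr
        _ ≤ _ := by nlinarith
  rw [integral_const_mul] at h1
  refine h1.trans ?_
  have := J_le (x := x / 4) (by positivity)
  gcongr

theorem norm_Gamma_sq {t : ℝ} (ht : 0 < t) :
    ‖Complex.Gamma (1 + t * Complex.I)‖ ^ 2 = π * t / Real.sinh (π * t) := by
  have hz : (t * Complex.I : ℂ) ≠ 0 := by simp [ht.ne']
  have h1 := Complex.Gamma_add_one _ hz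
  have h2 := Complex.Gamma_mul_Gamma_one_sub (t * Complex.I)
  have h3 : (1 - t * Complex.I : ℂ) = (starRingEnd ℂ) (1 + t * Complex.I) := by
    simp [sub_eq_add_neg]
  rw [h3, Complex.Gamma_conj] at h2
  have h4 : Complex.Gamma (1 + t * Complex.I) * (starRingEnd ℂ) (Complex.Gamma (1 + t * Complex.I))
      = (π * t / Real.sinh (π * t) : ℝ) := by
    have : (1 + t * Complex.I : ℂ) = t * Complex.I + 1 := by ring
    have hs : (Complex.sinh (π * t)) ≠ 0 := by
      rw [← Complex.ofReal_mul, ← Complex.ofReal_sinh]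
      exact_mod_cast (Real.sinh_pos_iff.2 (by positivity)).ne'
    nth_rewrite 1 [this]
    rw [h1, mul_assoc, h2, ← mul_assoc, Complex.sin_mul_I]
    push_cast
    field_simp
  rw [Complex.mul_conj, Complex.normSq_eq_norm_sq] at h4
  exact_mod_cast h4

theorem exp_image_univ : Set.image Real.exp univ = Ioi 0 := by
  rw [image_univ, Real.range_exp]

theorem integrable_expexp : Integrable (fun v : ℝ => Real.exp v * Real.exp (-Real.exp v)) := by
  have h := integrableOn_image_iff_integrableOn_abs_deriv_smul (s := univ) (f := Real.exp)
    (f' := Real.exp) MeasurableSet.univ (fun x _ => (Real.hasDerivAt_exp x).hasDerivWithinAt)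
    Real.exp_injective.injOn (fun y => Real.exp (-y))
  rw [exp_image_univ, integrableOn_univ] at h
  have h2 := h.1 (by simpa using exp_neg_integrableOn_Ioi 0 (b := 1) one_pos)
  simpa using h2

theorem Gamma_eq_int (t : ℝ) : Complex.Gamma (1 + t * Complex.I) =
    ∫ v : ℝ, ((Real.exp v * Real.exp (-Real.exp v) : ℝ) : ℂ) * Complex.exp (t * v * Complex.I) := by
  have h := integral_image_eq_integral_abs_deriv_smul (s := univ) (f := Real.exp)
    (f' := Real.exp) MeasurableSet.univ (fun x _ => (Real.hasDerivAt_exp x).hasDerivWithinAt)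
    Real.exp_injective.injOn (fun y : ℝ => ((-y).exp : ℂ) * (y : ℂ) ^ ((1 + t * Complex.I : ℂ) - 1))
  rw [exp_image_univ, setIntegral_univ] at h
  rw [Complex.Gamma_eq_integral (by simp), Complex.GammaIntegral, h]
  congr 1
  ext v
  have hv : (Real.exp v : ℂ) ≠ 0 := by exact_mod_cast (Real.exp_pos v).ne'
  rw [Complex.cpow_def_of_ne_zero hv, ← Complex.ofReal_log (Real.exp_pos v).le, Real.log_exp,
    abs_of_pos (Real.exp_pos v), Complex.real_smul]
  push_cast
  ring_nf

/-- the shifted integral -/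
def Gx (t x : ℝ) : ℂ :=
  ∫ v : ℝ, ((Real.exp v * Real.exp (-Real.exp v - x ^ 2 / 4 * Real.exp (-v)) : ℝ) : ℂ) *
    Complex.exp (t * v * Complex.I)

theorem norm_exp_phase (t v : ℝ) : ‖Complex.exp (t * v * Complex.I)‖ = 1 := by
  rw [← Complex.ofReal_mul, Complex.norm_exp_ofReal_mul_I]

theorem tendsto_Gx (t : ℝ) :
    Filter.Tendsto (Gx t) (nhdsWithin 0 (Ioi 0)) (nhds (Complex.Gamma (1 + t * Complex.I))) := by
  rw [Gamma_eq_int]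
  refine tendsto_integral_filter_of_dominated_convergence
    (fun v : ℝ => Real.exp v * Real.exp (-Real.exp v)) ?_ ?_ integrable_expexp ?_
  · refine Filter.Eventually.of_forall fun x => Continuous.aestronglyMeasurable ?_
    fun_prop
  · refine Filter.Eventually.of_forall fun x => Filter.Eventually.of_forall fun v => ?_
    rw [norm_mul, norm_exp_phase, mul_one, Complex.norm_real, Real.norm_of_nonneg (by positivity)]
    gcongr
    have : 0 ≤ x ^ 2 / 4 * Real.exp (-v) := by positivity
    linarith
  · refine Filter.Eventually.of_forall fun v => ?_
    have hc : Continuous fun x : ℝ =>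
      ((Real.exp v * Real.exp (-Real.exp v - x ^ 2 / 4 * Real.exp (-v)) : ℝ) : ℂ) *
        Complex.exp (t * v * Complex.I) := by fun_prop
    have := (hc.tendsto 0).mono_left (nhdsWithin_le_nhds (s := Ioi 0))
    simpa using this

/-- the unshifted integrand -/
def Hi (t x u : ℝ) : ℂ :=
  ((x * Real.exp u * Real.exp (-x * Real.cosh u) : ℝ) : ℂ) * Complex.exp (t * u * Complex.I)

theorem int_Hi_norm {x : ℝ} (hx : 0 < x) (t : ℝ) : ‖∫ u : ℝ, Hi t x u‖ = 2 * ‖Gx t x‖ := by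
  rw [← integral_add_right_eq_self (fun u => Hi t x u) (Real.log (2 / x))]
  have : ∀ v : ℝ, Hi t x (v + Real.log (2 / x)) =
      (2 * Complex.exp (t * (Real.log (2 / x) : ℝ) * Complex.I)) *
      (((Real.exp v * Real.exp (-Real.exp v - x ^ 2 / 4 * Real.exp (-v)) : ℝ) : ℂ) *
        Complex.exp (t * v * Complex.I)) := by
    intro v
    have h1 : Real.exp (v + Real.log (2 / x)) = Real.exp v * (2 / x) := by
      rw [Real.exp_add, Real.exp_log (by positivity)]
    have h2 : Real.exp (-(v + Real.log (2 / x))) = Real.exp (-v) * (x / 2) := by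
      rw [neg_add, Real.exp_add, Real.exp_neg (Real.log _), Real.exp_log (by positivity), inv_div]
    have h3 : -x * Real.cosh (v + Real.log (2 / x)) = -Real.exp v - x ^ 2 / 4 * Real.exp (-v) := by
      rw [Real.cosh_eq, h1, h2]
      field_simp
      ring
    have h4 : Complex.exp (t * ((v + Real.log (2 / x) : ℝ) : ℂ) * Complex.I) =
        Complex.exp (t * v * Complex.I) * Complex.exp (t * (Real.log (2 / x) : ℝ) * Complex.I) := by
      rw [← Complex.exp_add]
      push_cast
      ring_nf
    have h5 : x * (Real.exp v * (2 / x)) = 2 * Real.exp v := by field_simp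
    rw [Hi, h3, h4, h1, h5]
    push_cast
    ring
  simp_rw [this]
  rw [integral_const_mul, norm_mul, norm_mul, norm_exp_phase, Gx]
  simp

theorem cont_Hi (t x : ℝ) : Continuous (Hi t x) := by
  unfold Hi
  have := Real.continuous_cosh
  fun_prop

theorem norm_Hi_le {x : ℝ} (hx : 0 < x) (t u : ℝ) :
    ‖Hi t x u‖ ≤ 2 * x * (Real.cosh u ^ 1 * Real.exp (-x * Real.cosh u)) := by
  rw [Hi, norm_mul, norm_exp_phase, mul_one, Complex.norm_real, Real.norm_of_nonneg (by positivity)]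
  have h1 : Real.exp u ≤ 2 * Real.cosh u := by
    rw [Real.cosh_eq]; have := Real.exp_pos (-u); linarith
  have : x * Real.exp u * Real.exp (-x * Real.cosh u) ≤
    x * (2 * Real.cosh u) * Real.exp (-x * Real.cosh u) := by gcongr
  linarith

theorem int_Hi {x : ℝ} (hx : 0 < x) (t : ℝ) :
    ∫ u : ℝ, Hi t x u = 2 * ((x * Mom 1 t x : ℝ) + (t * Mom 0 t x : ℝ) * Complex.I) := by
  have i1 : IntegrableOn (Hi t x) (Ioi 0) :=
    Integrable.mono' ((integrable_dom hx (n := 1) (by norm_num)).const_mul (2 * x))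
      (cont_Hi t x).aestronglyMeasurable (Filter.Eventually.of_forall (norm_Hi_le hx t))
  have i2 : IntegrableOn (fun u => Hi t x (-u)) (Ioi 0) :=
    Integrable.mono' ((integrable_dom hx (n := 1) (by norm_num)).const_mul (2 * x))
      ((cont_Hi t x).comp continuous_neg).aestronglyMeasurable
      (Filter.Eventually.of_forall fun u => by
        have := norm_Hi_le hx t (-u)
        rwa [Real.cosh_neg] at this)
  have i3 : IntegrableOn (Hi t x) (Iic 0) := by
    have := (integrableOn_Ici_iff_integrableOn_Ioi (μ := volume)).2 i2
    have := this.comp_neg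
    simpa using this
  rw [← intervalIntegral.integral_Iic_add_Ioi i3 i1]
  have e := integral_comp_neg_Ioi 0 (Hi t x)
  rw [neg_zero] at e
  rw [← e, ← integral_add i2 i1, ibp1 hx]
  have hp : ∀ u, Hi t x (-u) + Hi t x u =
      2 * (((x * (Real.cosh u ^ 1 * (Real.exp (-x * Real.cosh u) * Real.cos (t * u))) : ℝ) : ℂ) +
      ((x * (Real.sinh u * (Real.exp (-x * Real.cosh u) * Real.sin (t * u))) : ℝ) : ℂ)
        * Complex.I) := by
    intro u
    have h1 : Complex.exp (t * u * Complex.I) = Complex.cos (t * u) + Complex.sin (t * u) * Complex.I :=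
      Complex.exp_mul_I _
    have h2 : Complex.exp (t * (-u : ℝ) * Complex.I) =
        Complex.cos (t * u) - Complex.sin (t * u) * Complex.I := by
      rw [Complex.exp_mul_I]
      push_cast
      rw [mul_neg, Complex.cos_neg, Complex.sin_neg]
      ring
    rw [Hi, Hi, h1, h2, Real.cosh_neg]
    have h3 : Real.exp u = Real.cosh u + Real.sinh u := (Real.cosh_add_sinh u).symm
    have h4 : Real.exp (-u) = Real.cosh u - Real.sinh u := (Real.cosh_sub_sinh u).symm
    rw [h3, h4]
    push_cast
    ring
  simp_rw [hp]
  have j1 : IntegrableOn (fun u => ((x * (Real.cosh u ^ 1 * (Real.exp (-x * Real.cosh u) *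
      Real.cos (t * u))) : ℝ) : ℂ)) (Ioi 0) :=
    Integrable.ofReal ((integrable_Mom hx (n := 1) (by norm_num) t).const_mul x)
  have j2 : IntegrableOn (fun u => ((x * (Real.sinh u * (Real.exp (-x * Real.cosh u) *
      Real.sin (t * u))) : ℝ) : ℂ)) (Ioi 0) := Integrable.ofReal (integrable_Sin1 hx t)
  rw [integral_const_mul, integral_add j1 (j2.mul_const _), integral_mul_const,
    integral_complex_ofReal, integral_complex_ofReal, integral_const_mul]
  rfl

theorem norm_Gx_sq {x : ℝ} (hx : 0 < x) (t : ℝ) :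
    ‖Gx t x‖ ^ 2 = (x * Mom 1 t x) ^ 2 + (t * Mom 0 t x) ^ 2 := by
  have h1 := int_Hi_norm hx t
  rw [int_Hi hx, norm_mul, Complex.norm_ofNat] at h1
  have h2 := mul_left_cancel₀ two_ne_zero h1
  rw [← h2, ← Complex.normSq_eq_norm_sq, Complex.normSq_add_mul_I]

theorem energy_deriv {x : ℝ} (hx : 0 < x) (t : ℝ) :
    HasDerivAt (fun y => (y * Mom 1 t y) ^ 2 + (t ^ 2 - y ^ 2) * Mom 0 t y ^ 2)
      (-(2 * x * Mom 0 t x ^ 2)) x := by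
  have h0 := hasDerivAt_Mom hx (n := 0) (by norm_num) t
  have h1 := hasDerivAt_Mom hx (n := 1) (by norm_num) t
  have h2 := (((hasDerivAt_id x).mul h1).pow 2).add
    ((((hasDerivAt_id x).pow 2).const_sub (t ^ 2)).mul (h0.pow 2))
  refine h2.congr_deriv ?_
  have := ode hx t
  simp [id]
  linear_combination (-2 * Mom 1 t x) * this

theorem energy_antitone (t : ℝ) :
    AntitoneOn (fun y => (y * Mom 1 t y) ^ 2 + (t ^ 2 - y ^ 2) * Mom 0 t y ^ 2) (Ioi 0) := by
  refine antitoneOn_of_hasDerivWithinAt_nonpos (convex_Ioi 0)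
    (f' := fun x => -(2 * x * Mom 0 t x ^ 2)) ?_ ?_ ?_
  · intro x hx
    exact (energy_deriv hx t).continuousAt.continuousWithinAt
  · intro x hx
    rw [interior_Ioi] at hx
    exact (energy_deriv hx t).hasDerivWithinAt
  · intro x hx
    rw [interior_Ioi] at hx
    have : (0 : ℝ) < x := hx
    have : 0 ≤ 2 * x * Mom 0 t x ^ 2 := by positivity
    linarith

theorem energy_le {t x : ℝ} (ht : 0 < t) (hx : 0 < x) :
    (x * Mom 1 t x) ^ 2 + (t ^ 2 - x ^ 2) * Mom 0 t x ^ 2 ≤ π * t / Real.sinh (π * t) := by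
  rw [← norm_Gamma_sq ht]
  have h := ((tendsto_Gx t).norm).pow 2
  refine ge_of_tendsto h ?_
  filter_upwards [Ioo_mem_nhdsGT hx] with y hy
  rw [norm_Gx_sq hy.1]
  have := energy_antitone t hy.1 hx hy.2.le
  simp only at this
  nlinarith [sq_nonneg (y * Mom 0 t y)]

theorem sinh_bound {t : ℝ} (ht : 1 ≤ t) :
    π * t / Real.sinh (π * t) ≤ 16 * t * Real.exp (-(π * t / 2)) ^ 2 := by
  have h3 := Real.pi_gt_three
  have h4 := Real.pi_le_four
  have hpt : 1 ≤ π * t := by nlinarith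
  have h1 := Real.add_one_le_exp (π * t)
  have h2 : Real.exp (-(π * t)) * Real.exp (π * t) = 1 := by rw [← Real.exp_add]; simp
  have h5 : Real.exp (-(π * t / 2)) ^ 2 = Real.exp (-(π * t)) := by
    rw [← Real.exp_nat_mul]; congr 1; push_cast; ring
  have h6 : Real.exp (π * t) / 4 ≤ Real.sinh (π * t) := by
    rw [Real.sinh_eq]
    have : Real.exp (-(π * t)) ≤ 1 := Real.exp_le_one_iff.2 (by linarith)
    linarith
  have h7 := Real.exp_pos (π * t)
  rw [h5, div_le_iff₀ (by linarith)]
  have h8 := Real.exp_pos (-(π * t))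
  calc π * t ≤ 4 * t * (Real.exp (-(π * t)) * Real.exp (π * t)) := by rw [h2]; nlinarith
    _ = 16 * t * Real.exp (-(π * t)) * (Real.exp (π * t) / 4) := by ring
    _ ≤ _ := by gcongr

theorem energy_le' {t x : ℝ} (ht : 1 ≤ t) (hx : 0 < x) :
    (x * Mom 1 t x) ^ 2 + (t ^ 2 - x ^ 2) * Mom 0 t x ^ 2 ≤
      16 * t * Real.exp (-(π * t / 2)) ^ 2 :=
  (energy_le (by linarith) hx).trans (sinh_bound ht)

theorem Mom1_le {t x : ℝ} (ht : 1 ≤ t) (hx : 0 < x) (hxt : x ≤ t) :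
    x * |Mom 1 t x| ≤ 4 * Real.sqrt t * Real.exp (-(π * t / 2)) := by
  have h := energy_le' ht hx
  have hs := Real.sq_sqrt (by linarith : (0 : ℝ) ≤ t)
  have h1 : 0 ≤ (t ^ 2 - x ^ 2) * Mom 0 t x ^ 2 := by
    apply mul_nonneg _ (sq_nonneg _); nlinarith
  have h2 : (x * Mom 1 t x) ^ 2 ≤ (4 * Real.sqrt t * Real.exp (-(π * t / 2))) ^ 2 := by
    rw [mul_pow (4 * Real.sqrt t), mul_pow (4 : ℝ), hs]; linarith
  have h3 := abs_le_of_sq_le_sq h2 (by positivity)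
  rw [← abs_of_pos hx, ← abs_mul, abs_of_pos hx]
  exact h3

theorem Mom0_le {t x : ℝ} (ht : 1 ≤ t) (hx : 0 < x) (hxt : x ≤ t) :
    |Mom 0 t x| ≤ 10 * Real.exp (-(π * t / 2)) := by
  set q := Real.exp (-(π * t / 2)) with hq
  have hq0 : 0 < q := Real.exp_pos _
  set r := Real.sqrt t with hr
  have hr2 : r ^ 2 = t := Real.sq_sqrt (by linarith)
  have hr1 : 1 ≤ r := Real.one_le_sqrt.2 ht
  set y := x * (1 - 1 / (2 * r)) with hy
  have hd : 1 / (2 * r) ≤ 1 / 2 := by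
    rw [div_le_div_iff₀ (by positivity) (by norm_num)]; linarith
  have hd0 : 0 < 1 / (2 * r) := by positivity
  have hy2 : x / 2 ≤ y := by rw [hy]; nlinarith
  have hyx : y ≤ x := by rw [hy]; nlinarith
  have hy0 : 0 < y := by linarith
  -- value at y
  have hA : |Mom 0 t y| ≤ 6 * q := by
    have h := energy_le' ht hy0
    rw [← hq] at h
    have hyt : y ≤ t * (1 - 1 / (2 * r)) := by
      rw [hy]; apply mul_le_mul_of_nonneg_right hxt; linarith
    have hsq : y ^ 2 ≤ (t * (1 - 1 / (2 * r))) ^ 2 := by gcongr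
    have hg : t * r / 2 ≤ t ^ 2 - y ^ 2 := by
      have e1 : t * r / 2 = t ^ 2 * (1 / (2 * r)) := by
        field_simp
        rw [hr2]
      have e2 : 0 ≤ t ^ 2 * (1 / (2 * r)) * (1 - 1 / (2 * r)) := by
        apply mul_nonneg (by positivity); linarith
      rw [e1]; nlinarith
    have h5 : t * r / 2 * Mom 0 t y ^ 2 ≤ 16 * t * q ^ 2 := by
      have := mul_le_mul_of_nonneg_right hg (sq_nonneg (Mom 0 t y))
      nlinarith [sq_nonneg (y * Mom 1 t y)]
    have h6 : t / 2 * Mom 0 t y ^ 2 ≤ t * r / 2 * Mom 0 t y ^ 2 := by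
      gcongr; nlinarith
    have h7 : Mom 0 t y ^ 2 ≤ 32 * q ^ 2 := by
      by_contra hcon
      push Not at hcon
      nlinarith
    have h8 : Mom 0 t y ^ 2 ≤ (6 * q) ^ 2 := by nlinarith [sq_nonneg q]
    exact abs_le.2 (abs_le_of_sq_le_sq' h8 (by positivity))
  have hB : ‖Mom 0 t x - Mom 0 t y‖ ≤ (8 * r * q / x) * ‖x - y‖ := by
    refine Convex.norm_image_sub_le_of_norm_hasDerivWithin_le (s := Icc y x)
      (f' := fun z => -Mom (0 + 1) t z) ?_ ?_ (convex_Icc y x) (left_mem_Icc.2 hyx)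
      (right_mem_Icc.2 hyx)
    · intro z hz
      exact (hasDerivAt_Mom (by linarith [hz.1]) (by norm_num) t).hasDerivWithinAt
    · intro z hz
      have hz0 : 0 < z := by linarith [hz.1]
      have h := Mom1_le ht hz0 (hz.2.trans hxt)
      rw [norm_neg, Real.norm_eq_abs, zero_add, le_div_iff₀ hx]
      have := mul_le_mul_of_nonneg_right (hy2.trans hz.1) (abs_nonneg (Mom 1 t z))
      rw [← hq, ← hr] at h
      linarith
  have hxy : ‖x - y‖ = x * (1 / (2 * r)) := by
    rw [Real.norm_of_nonneg (by linarith), hy]; ring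
  have e : 8 * r * q / x * (x * (1 / (2 * r))) = 4 * q := by
    field_simp
    norm_num
  rw [hxy, e, Real.norm_eq_abs] at hB
  have := abs_sub_abs_le_abs_sub (Mom 0 t x) (Mom 0 t y)
  linarith

theorem tendsto_B : Filter.Tendsto
    (fun x : ℝ => 8 * Real.exp (-(x / 4)) * (|Real.log (x / 4)| + 2)) Filter.atTop (nhds 0) := by
  have h4 : Filter.Tendsto (fun x : ℝ => x / 4) Filter.atTop Filter.atTop :=
    Filter.tendsto_id.atTop_div_const (by norm_num)
  have h1 := (Real.tendsto_pow_mul_exp_neg_atTop_nhds_zero 1).comp h4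
  have h0 := (Real.tendsto_pow_mul_exp_neg_atTop_nhds_zero 0).comp h4
  have h := (h1.const_mul 8).add (h0.const_mul 16)
  simp only [mul_zero, add_zero] at h
  refine squeeze_zero' (Filter.Eventually.of_forall fun x => by positivity) ?_ h
  filter_upwards [Filter.eventually_ge_atTop 4] with x hx
  have hl : |Real.log (x / 4)| ≤ x / 4 := by
    rw [abs_of_nonneg (Real.log_nonneg (by linarith))]
    exact Real.log_le_self (by linarith)
  simp only [Function.comp, pow_one, pow_zero, one_mul]
  have := mul_le_mul_of_nonneg_left hl (Real.exp_pos (-(x / 4))).le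
  linarith

theorem F_deriv {x : ℝ} (hx : 0 < x) (t : ℝ) :
    HasDerivAt (fun y => -(y * Mom 1 t y * Mom 0 t y))
      (x * Mom 1 t x ^ 2 + (x ^ 2 - t ^ 2) / x * Mom 0 t x ^ 2) x := by
  have h0 := hasDerivAt_Mom hx (n := 0) (by norm_num) t
  have h1 := hasDerivAt_Mom hx (n := 1) (by norm_num) t
  refine ((((hasDerivAt_id x).mul h1).mul h0).neg).congr_deriv ?_
  have := ode hx t
  simp [id]
  field_simp
  linear_combination (Mom 0 t x) * this

theorem F_nonpos {t x : ℝ} (ht : 0 < t) (hxt : t ≤ x) : -(x * Mom 1 t x * Mom 0 t x) ≤ 0 := by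
  have hmono : MonotoneOn (fun y => -(y * Mom 1 t y * Mom 0 t y)) (Ici t) := by
    refine monotoneOn_of_hasDerivWithinAt_nonneg (convex_Ici t)
      (f' := fun x => x * Mom 1 t x ^ 2 + (x ^ 2 - t ^ 2) / x * Mom 0 t x ^ 2) ?_ ?_ ?_
    · intro y hy
      exact (F_deriv (ht.trans_le hy) t).continuousAt.continuousWithinAt
    · intro y hy
      rw [interior_Ici] at hy
      exact (F_deriv (ht.trans hy) t).hasDerivWithinAt
    · intro y hy
      rw [interior_Ici] at hy
      have h1 : t < y := hy
      have h2 : 0 < y := ht.trans h1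
      have h3 : 0 ≤ y ^ 2 - t ^ 2 := by nlinarith
      positivity
  have hlim : Filter.Tendsto (fun y => -(y * Mom 1 t y * Mom 0 t y)) Filter.atTop (nhds 0) := by
    have := tendsto_B.mul tendsto_B
    rw [mul_zero] at this
    refine squeeze_zero_norm' ?_ this
    filter_upwards [Filter.eventually_gt_atTop 0] with y hy
    have h1 := Mom_direct hy (n := 1) (by norm_num) t
    have h0 := Mom_direct hy (n := 0) (by norm_num) t
    rw [pow_one] at h1
    rw [pow_zero, one_mul] at h0
    rw [norm_neg, norm_mul]
    exact mul_le_mul h1 h0 (norm_nonneg _) (by positivity)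
  refine ge_of_tendsto hlim ?_
  filter_upwards [Filter.eventually_ge_atTop x] with z hz
  exact hmono hxt (hxt.trans hz) hz

theorem Mom0_le' {t x : ℝ} (ht : 1 ≤ t) (hx : 0 < x) :
    |Mom 0 t x| ≤ 10 * Real.exp (-(π * t / 2)) := by
  rcases le_total x t with hxt | hxt
  · exact Mom0_le ht hx hxt
  have ht0 : 0 < t := by linarith
  refine le_trans ?_ (Mom0_le ht ht0 le_rfl)
  have hd : ∀ y, 0 < y → HasDerivAt (fun y => Mom 0 t y ^ 2) (-2 * Mom 1 t y * Mom 0 t y) y := by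
    intro y hy
    refine ((hasDerivAt_Mom hy (n := 0) (by norm_num) t).pow 2).congr_deriv ?_
    simp
    ring
  have hanti : AntitoneOn (fun y => Mom 0 t y ^ 2) (Ici t) := by
    refine antitoneOn_of_hasDerivWithinAt_nonpos (convex_Ici t)
      (f' := fun y => -2 * Mom 1 t y * Mom 0 t y) ?_ ?_ ?_
    · intro y hy
      exact (hd y (ht0.trans_le hy)).continuousAt.continuousWithinAt
    · intro y hy
      rw [interior_Ici] at hy
      exact (hd y (ht0.trans hy)).hasDerivWithinAt
    · intro y hy
      rw [interior_Ici] at hy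
      have h1 : t < y := hy
      have h2 : 0 < y := ht0.trans h1
      have h3 := F_nonpos ht0 h1.le
      by_contra hcon
      push Not at hcon
      nlinarith
  exact sq_le_sq.1 (hanti (self_mem_Ici) hxt hxt)

theorem Mom_le_energy {t x : ℝ} (ht : 1 ≤ t) (hx : 0 < x) (hxt : x ≤ 8 * t) {n : ℕ} (hn : n ≤ 2) :
    |x ^ n * Mom n t x| ≤ 721 * t ^ n * Real.exp (-(π * t / 2)) := by
  set q := Real.exp (-(π * t / 2)) with hq
  have hq0 : 0 < q := Real.exp_pos _
  have h0 : |Mom 0 t x| ≤ 10 * q := Mom0_le' ht hx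
  have hx2 : x ^ 2 ≤ 64 * t ^ 2 := by nlinarith
  have h0s : Mom 0 t x ^ 2 ≤ 100 * q ^ 2 := by
    have := sq_le_sq' (by linarith [neg_abs_le (Mom 0 t x), abs_nonneg (Mom 0 t x)]) h0
    rw [sq_abs] at this
    linarith
  have h1 : |x * Mom 1 t x| ≤ 81 * t * q := by
    have h := energy_le' ht hx
    rw [← hq] at h
    have a1 : x ^ 2 * Mom 0 t x ^ 2 ≤ 64 * t ^ 2 * (100 * q ^ 2) := by gcongr
    have a2 : 16 * t * q ^ 2 ≤ 16 * t ^ 2 * q ^ 2 := by gcongr; nlinarith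
    have a3 : 0 ≤ t ^ 2 * Mom 0 t x ^ 2 := by positivity
    have a4 : 0 ≤ t ^ 2 * q ^ 2 := by positivity
    refine abs_le.2 (abs_le_of_sq_le_sq' ?_ (by positivity))
    nlinarith
  interval_cases n
  · simp only [pow_zero, one_mul, mul_one]; linarith
  · simp only [pow_one]
    have : 0 < t * q := by positivity
    linarith
  · have e : x ^ 2 * Mom 2 t x = x * Mom 1 t x + (x ^ 2 - t ^ 2) * Mom 0 t x := by
      linarith [ode hx t]
    rw [e]
    refine (abs_add_le _ _).trans ?_
    rw [abs_mul (x ^ 2 - t ^ 2)]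
    have b1 : |x ^ 2 - t ^ 2| ≤ 64 * t ^ 2 := by
      rw [abs_le]; constructor <;> nlinarith [sq_nonneg x, sq_nonneg t]
    have b2 : |x ^ 2 - t ^ 2| * |Mom 0 t x| ≤ 64 * t ^ 2 * (10 * q) := by gcongr
    have b3 : 81 * t * q ≤ 81 * t ^ 2 * q := by gcongr; nlinarith
    linarith

theorem Mom_abs (n : ℕ) (t x : ℝ) : Mom n |t| x = Mom n t x := by
  rcases abs_choice t with h | h
  · rw [h]
  · rw [h]; simp [Mom]

theorem Mom_main {x : ℝ} (hx : 0 < x) (t : ℝ) {n : ℕ} (hn : n ≤ 2) :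
    |x ^ n * Mom n t x| ≤
      721 * (1 + |Real.log x|) * (1 + |t|) ^ n * Real.exp (-(π * |t| / 2)) := by
  rw [← Mom_abs]
  have ht : 0 ≤ |t| := abs_nonneg t
  generalize |t| = s at *
  have hl := abs_nonneg (Real.log x)
  have hs1 : 1 ≤ (1 + s) ^ n := one_le_pow₀ (by linarith)
  by_cases hc : 1 ≤ s ∧ x ≤ 8 * s
  · refine (Mom_le_energy hc.1 hx hc.2 hn).trans ?_
    have : s ^ n ≤ (1 + s) ^ n := by gcongr; linarith
    gcongr
    nlinarith [pow_nonneg ht n]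
  · refine (Mom_direct hx hn s).trans ?_
    have h4 : |Real.log (x / 4)| ≤ |Real.log x| + 2 := by
      rw [Real.log_div hx.ne' (by norm_num)]
      refine (abs_sub _ _).trans ?_
      have : Real.log 4 ≤ 2 := by
        have : (4 : ℝ) = 2 ^ 2 := by norm_num
        rw [this, Real.log_pow]
        have := Real.log_two_lt_d9
        push_cast
        linarith
      rw [abs_of_nonneg (Real.log_nonneg (by norm_num : (1 : ℝ) ≤ 4))]
      linarith
    have he : Real.exp (-(x / 4)) ≤ 9 * Real.exp (-(π * s / 2)) := by
      have hp := Real.pi_le_four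
      rcases not_and_or.1 hc with h | h
      · push Not at h
        have e1 : Real.exp (-(x / 4)) ≤ 1 := Real.exp_le_one_iff.2 (by linarith)
        have e2 : Real.exp (-2) ≤ Real.exp (-(π * s / 2)) := by
          apply Real.exp_le_exp.2
          nlinarith
        have e3 : Real.exp (-2) * Real.exp 2 = 1 := by rw [← Real.exp_add]; simp
        have e4 : Real.exp 2 ≤ 9 := by
          have : Real.exp 2 = Real.exp 1 ^ 2 := by rw [← Real.exp_nat_mul]; norm_num
          rw [this]
          have := Real.exp_one_lt_d9
          have := Real.exp_pos 1
          nlinarith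
        have := Real.exp_pos (-2)
        nlinarith
      · push Not at h
        have : Real.exp (-(x / 4)) ≤ Real.exp (-(π * s / 2)) := by
          apply Real.exp_le_exp.2
          nlinarith
        have := Real.exp_pos (-(π * s / 2))
        linarith
    have hE := Real.exp_pos (-(π * s / 2))
    calc 8 * Real.exp (-(x / 4)) * (|Real.log (x / 4)| + 2)
        ≤ 8 * (9 * Real.exp (-(π * s / 2))) * (|Real.log x| + 2 + 2) := by gcongr
      _ ≤ 721 * (1 + |Real.log x|) * 1 * Real.exp (-(π * s / 2)) := by
        have := mul_nonneg hl hE.le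
        nlinarith
      _ ≤ _ := by gcongr

theorem Mom_scaled {τ : ℝ} (hτ : 0 < τ) (t : ℝ) {n : ℕ} (hn : n ≤ 2) :
    |(2 * π * τ) ^ n * Mom n t (2 * π * τ)| ≤
      2163 * (1 + |Real.log τ|) * (1 + |t|) ^ n * Real.exp (-(π * |t| / 2)) := by
  have hp := Real.pi_pos
  refine (Mom_main (x := 2 * π * τ) (by positivity) t hn).trans ?_
  have h1 : |Real.log (2 * π * τ)| ≤ 2 + |Real.log τ| := by
    rw [Real.log_mul (by positivity) hτ.ne']
    refine (abs_add_le _ _).trans ?_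
    have h3 := Real.pi_gt_three
    have : Real.log (2 * π) ≤ 2 := by
      rw [Real.log_le_iff_le_exp (by positivity)]
      have : Real.exp 2 = Real.exp 1 ^ 2 := by rw [← Real.exp_nat_mul]; norm_num
      rw [this]
      have := Real.exp_one_gt_d9
      have := Real.pi_lt_d2
      nlinarith
    rw [abs_of_nonneg (Real.log_nonneg (by linarith))]
    linarith
  have h2 : 721 * (1 + |Real.log (2 * π * τ)|) ≤ 2163 * (1 + |Real.log τ|) := by
    have := abs_nonneg (Real.log τ)
    linarith
  gcongr

theorem h_deriv1 {τ : ℝ} (hτ : 0 < τ) (c t : ℝ) :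
    HasDerivAt (fun τ' : ℝ => c * 2 * Real.sqrt τ' * Kit t (2 * π * τ'))
      (c * 2 * (1 / (2 * Real.sqrt τ)) * Mom 0 t (2 * π * τ) +
        c * 2 * Real.sqrt τ * (-Mom 1 t (2 * π * τ) * (2 * π))) τ := by
  have hp := Real.pi_pos
  have hx : 0 < 2 * π * τ := by positivity
  have hl : HasDerivAt (fun y : ℝ => 2 * π * y) (2 * π) τ := by
    simpa using (hasDerivAt_id τ).const_mul (2 * π)
  have h0 : HasDerivAt (fun y => Kit t (2 * π * y)) (-Mom 1 t (2 * π * τ) * (2 * π)) τ := by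
    have := (hasDerivAt_Mom hx (n := 0) (by norm_num) t).comp τ hl
    simp only [zero_add] at this
    refine this.congr_of_eventuallyEq (Filter.Eventually.of_forall fun y => ?_)
    simp [Mom_zero]
  have hs := (Real.hasDerivAt_sqrt hτ.ne').const_mul (c * 2)
  refine (hs.mul h0).congr_deriv ?_
  rw [Mom_zero]

theorem h_deriv2 {τ : ℝ} (hτ : 0 < τ) (c t : ℝ) :
    HasDerivAt (fun τ : ℝ => c * 2 * (1 / (2 * Real.sqrt τ)) * Mom 0 t (2 * π * τ) +
        c * 2 * Real.sqrt τ * (-Mom 1 t (2 * π * τ) * (2 * π)))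
      (c * 2 * (Real.sqrt τ / τ ^ 2 * (-((2 * π * τ) ^ 0 * Mom 0 t (2 * π * τ)) / 4
        - (2 * π * τ) ^ 1 * Mom 1 t (2 * π * τ) + (2 * π * τ) ^ 2 * Mom 2 t (2 * π * τ)))) τ := by
  have hp := Real.pi_pos
  have hx : 0 < 2 * π * τ := by positivity
  have hr : 0 < Real.sqrt τ := Real.sqrt_pos.2 hτ
  have hl : HasDerivAt (fun y : ℝ => 2 * π * y) (2 * π) τ := by
    simpa using (hasDerivAt_id τ).const_mul (2 * π)
  have h0 := (hasDerivAt_Mom hx (n := 0) (by norm_num) t).comp τ hl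
  have h1 := (hasDerivAt_Mom hx (n := 1) (by norm_num) t).comp τ hl
  have hs := (Real.hasDerivAt_sqrt hτ.ne')
  have hi := ((hs.const_mul 2).inv (by positivity)).const_mul (c * 2)
  have H := (hi.mul h0).add ((hs.const_mul (c * 2)).mul (h1.neg.mul_const (2 * π)))
  have hr2 : τ = Real.sqrt τ ^ 2 := (Real.sq_sqrt hτ.le).symm
  refine (H.congr_of_eventuallyEq (Filter.Eventually.of_forall fun y => ?_)).congr_deriv ?_
  · simp [Function.comp]
  · simp only [Function.comp, zero_add]
    generalize Mom 0 t (2 * π * τ) = m0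
    norm_num
    generalize Mom 1 t (2 * π * τ) = m1
    generalize Mom 2 t (2 * π * τ) = m2
    generalize hR : Real.sqrt τ = R at *
    subst hr2
    field_simp
    ring

/-- Bounds for h(t;τ) = cosh(αt)·2√τ·K_{it}(2πτ) and its first two derivatives in τ. -/
theorem stmt18 : ∃ C : ℝ, 0 < C ∧
    ∀ α : ℝ, 0 ≤ α → α < π / 2 →
    ∀ t τ : ℝ, 0 < τ →
    DifferentiableAt ℝ (fun τ' : ℝ => Real.cosh (α * t) * 2 * Real.sqrt τ' * Kit t (2 * π * τ')) τ ∧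
    DifferentiableAt ℝ
      (deriv (fun τ' : ℝ => Real.cosh (α * t) * 2 * Real.sqrt τ' * Kit t (2 * π * τ'))) τ ∧
    ∀ j : ℕ, j ≤ 2 →
      |iteratedDeriv j (fun τ' : ℝ => Real.cosh (α * t) * 2 * Real.sqrt τ' * Kit t (2 * π * τ')) τ| ≤
        C * (1 + |Real.log τ|) * Real.sqrt τ * ((1 + |t|) / τ) ^ j *
          Real.exp (-(π / 2 - α) * |t|) := by
  refine ⟨10000, by norm_num, ?_⟩
  intro α hα0 hα t τ hτ
  have hp := Real.pi_pos
  have hc : Real.cosh (α * t) ≤ Real.exp (α * |t|) := by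
    rw [← Real.cosh_abs, abs_mul, abs_of_nonneg hα0, Real.cosh_eq]
    have : Real.exp (-(α * |t|)) ≤ Real.exp (α * |t|) := by
      apply Real.exp_le_exp.2
      have := mul_nonneg hα0 (abs_nonneg t)
      linarith
    linarith
  have hc0 := Real.cosh_pos (α * t)
  have hqe : Real.exp (α * |t|) * Real.exp (-(π * |t| / 2)) = Real.exp (-(π / 2 - α) * |t|) := by
    rw [← Real.exp_add]; ring_nf
  generalize Real.cosh (α * t) = c at *
  have hd1 := h_deriv1 hτ c t
  have hev : deriv (fun τ' : ℝ => c * 2 * Real.sqrt τ' * Kit t (2 * π * τ')) =ᶠ[nhds τ]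
      (fun τ : ℝ => c * 2 * (1 / (2 * Real.sqrt τ)) * Mom 0 t (2 * π * τ) +
        c * 2 * Real.sqrt τ * (-Mom 1 t (2 * π * τ) * (2 * π))) := by
    filter_upwards [Ioi_mem_nhds hτ] with y hy
    exact (h_deriv1 hy c t).deriv
  have hd2 := (h_deriv2 hτ c t).congr_of_eventuallyEq hev
  refine ⟨hd1.differentiableAt, hd2.differentiableAt, ?_⟩
  have hr : 0 < Real.sqrt τ := Real.sqrt_pos.2 hτ
  have hr2 : τ = Real.sqrt τ ^ 2 := (Real.sq_sqrt hτ.le).symm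
  have b0 := Mom_scaled hτ t (n := 0) (by norm_num)
  have b1 := Mom_scaled hτ t (n := 1) (by norm_num)
  have b2 := Mom_scaled hτ t (n := 2) (by norm_num)
  have hΛ : 0 < 1 + |Real.log τ| := by positivity
  have hq0 := Real.exp_pos (-(π * |t| / 2))
  have hT : 1 ≤ 1 + |t| := by linarith [abs_nonneg t]
  have fin : ∀ (j : ℕ) (A : ℝ), |A| ≤ 5000 * (1 + |Real.log τ|) * (1 + |t|) ^ j *
      Real.exp (-(π * |t| / 2)) → |c * 2 * (Real.sqrt τ / τ ^ j * A)| ≤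
        10000 * (1 + |Real.log τ|) * Real.sqrt τ * ((1 + |t|) / τ) ^ j *
          Real.exp (-(π / 2 - α) * |t|) := by
    intro j A hA
    rw [abs_mul, abs_mul (Real.sqrt τ / τ ^ j), abs_of_pos (by positivity : 0 < c * 2),
      abs_of_pos (by positivity : 0 < Real.sqrt τ / τ ^ j), ← hqe]
    calc c * 2 * (Real.sqrt τ / τ ^ j * |A|) ≤ Real.exp (α * |t|) * 2 * (Real.sqrt τ / τ ^ j *
          (5000 * (1 + |Real.log τ|) * (1 + |t|) ^ j * Real.exp (-(π * |t| / 2)))) := by gcongr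
      _ = _ := by rw [div_pow]; field_simp; ring
  set W := 2163 * (1 + |Real.log τ|) * Real.exp (-(π * |t| / 2)) with hW
  have hW0 : 0 < W := by positivity
  have b0' : |(2 * π * τ) ^ 0 * Mom 0 t (2 * π * τ)| ≤ W := by
    refine b0.trans (le_of_eq ?_); rw [hW]; ring
  have b1' : |(2 * π * τ) ^ 1 * Mom 1 t (2 * π * τ)| ≤ W * (1 + |t|) := by
    refine b1.trans (le_of_eq ?_); rw [hW]; ring
  have b2' : |(2 * π * τ) ^ 2 * Mom 2 t (2 * π * τ)| ≤ W * (1 + |t|) ^ 2 := by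
    refine b2.trans (le_of_eq ?_); rw [hW]; ring
  have hW1 : W ≤ W * (1 + |t|) := by nlinarith
  have hW2 : W * (1 + |t|) ≤ W * (1 + |t|) ^ 2 := by nlinarith
  have hfac : ∀ P : ℝ, 5000 * (1 + |Real.log τ|) * P * Real.exp (-(π * |t| / 2)) =
      5000 / 2163 * (W * P) := by intro P; rw [hW]; ring
  intro j hj
  interval_cases j
  · rw [iteratedDeriv_zero]
    have := fin 0 ((2 * π * τ) ^ 0 * Mom 0 t (2 * π * τ)) (by
      rw [hfac, pow_zero (1 + |t|), mul_one]; linarith)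
    convert this using 2
    rw [Mom_zero]; simp; ring
  · rw [iteratedDeriv_one, hd1.deriv]
    have := fin 1 ((2 * π * τ) ^ 0 * Mom 0 t (2 * π * τ) / 2 -
        (2 * π * τ) ^ 1 * Mom 1 t (2 * π * τ)) (by
      rw [hfac, pow_one (1 + |t|)]
      refine (abs_sub _ _).trans ?_
      rw [abs_div, abs_two]
      linarith)
    convert this using 2
    generalize Mom 0 t (2 * π * τ) = m0
    generalize Mom 1 t (2 * π * τ) = m1
    have h5 : 1 / (2 * Real.sqrt τ) = Real.sqrt τ / τ / 2 := by
      rw [div_div, div_eq_div_iff (by positivity) (by positivity)]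
      nlinarith
    rw [h5]
    field_simp
    ring
  · rw [iteratedDeriv_succ, iteratedDeriv_one, hd2.deriv]
    refine fin 2 _ ?_
    rw [hfac]
    refine (abs_add_le _ _).trans ?_
    have := abs_sub (-((2 * π * τ) ^ 0 * Mom 0 t (2 * π * τ)) / 4)
      ((2 * π * τ) ^ 1 * Mom 1 t (2 * π * τ))
    rw [abs_div, abs_neg, abs_of_pos (by norm_num : (0 : ℝ) < 4)] at this
    linarith
end
end

section
/- There is an absolute constant C > 0 such that for every t ∈ ℝ the function u ↦ Ξ_t(u) is twice differentiable on (0, ∞) and the following bounds hold: |Ξ_t(u)| ≤ C for 0 ≤ u ≤ 2 and |Ξ_t(u)| ≤ C·log(u)·u^{−1/2} for u ≥ 2; |Ξ_t′(u)| ≤ C·(1+t²) for 0 < u ≤ 2 and |Ξ_t′(u)| ≤ C·(1+t²)·log(u)·u^{−3/2} for u ≥ 2; |Ξ_t″(u)| ≤ C·(1+t²)·u^{−1} for 0 < u ≤ 2 and |Ξ_t″(u)| ≤ C·(1+t²)·log(u)·u^{−5/2} for u ≥ 2. -/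
open MeasureTheory Real Set

noncomputable section

/-- Inverse hyperbolic cosine. -/
def acosh (x : ℝ) : ℝ := Real.log (x + Real.sqrt (x ^ 2 - 1))

/-- Mehler's integral representation of the spherical function
    Ξ_t(u) = (√2/π)·∫₀^{ϑ(u)} cos(tα)/√(2(cosh ϑ(u) − cosh α)) dα, ϑ(u) = arccosh(2u+1). -/
def XiFun (t u : ℝ) : ℝ :=
  (Real.sqrt 2 / π) * ∫ a in Set.Ioo (0 : ℝ) (acosh (2 * u + 1)),
    Real.cos (t * a) / Real.sqrt (2 * (Real.cosh (acosh (2 * u + 1)) - Real.cosh a))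


lemma param_deriv (w f f' : ℝ → ℝ) (hw : Continuous w) (hf : ∀ x, HasDerivAt f (f' x) x)
    (hf' : Continuous f') (s : ℝ) :
    HasDerivAt (fun s => ∫ p in (0:ℝ)..(π / 2), w p * f (s * sin p))
      (∫ p in (0:ℝ)..(π / 2), (w p * sin p) * f' (s * sin p)) s := by
  have hfc : Continuous f := continuous_iff_continuousAt.2 fun x => (hf x).continuousAt
  obtain ⟨B, hB⟩ := (isCompact_Icc (a := -(|s| + 1)) (b := |s| + 1)).exists_bound_of_continuousOn
    hf'.continuousOn
  refine (intervalIntegral.hasDerivAt_integral_of_dominated_loc_of_deriv_le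
    (F := fun s p => w p * f (s * sin p)) (F' := fun s p => (w p * sin p) * f' (s * sin p))
    (bound := fun p => |w p * sin p| * B)
    (Metric.ball_mem_nhds s one_pos) ?_ ?_ ?_ ?_ ?_ ?_).2
  · refine Filter.Eventually.of_forall fun x => ?_
    exact (by fun_prop : Continuous fun p => w p * f (x * sin p)).aestronglyMeasurable
  · exact (by fun_prop : Continuous fun p => w p * f (s * sin p)).intervalIntegrable _ _
  · exact (by fun_prop : Continuous fun p => (w p * sin p) * f' (s * sin p)).aestronglyMeasurable
  · refine Filter.Eventually.of_forall fun p _ x hx => ?_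
    rw [norm_mul, Real.norm_eq_abs]
    refine mul_le_mul_of_nonneg_left (hB _ ?_) (abs_nonneg _)
    rw [Metric.mem_ball, Real.dist_eq] at hx
    have h1 : |x| ≤ |s| + 1 := by
      have := abs_sub_abs_le_abs_sub x s
      linarith
    have h2 : |x * sin p| ≤ |s| + 1 := by
      rw [abs_mul]
      nlinarith [abs_nonneg x, abs_sin_le_one p, abs_nonneg (sin p)]
    exact ⟨(abs_le.1 h2).1, (abs_le.1 h2).2⟩
  · exact (by fun_prop : Continuous fun p => |w p * sin p| * B).intervalIntegrable _ _
  · refine Filter.Eventually.of_forall fun p _ x _ => ?_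
    have h := ((hf (x * sin p)).comp x ((hasDerivAt_id x).mul_const (sin p))).const_mul (w p)
    refine h.congr_deriv ?_
    ring

def gz (t x : ℝ) : ℝ := cos (2 * t * arsinh x) / √(1 + x ^ 2)

def gf (t x : ℝ) : ℝ :=
  -(2 * t * sin (2 * t * arsinh x)) / (1 + x ^ 2) - x * gz t x / (1 + x ^ 2)

def gs (t x : ℝ) : ℝ := -(3 * x * gf t x + (1 + 4 * t ^ 2) * gz t x) / (1 + x ^ 2)

lemma cpos (x : ℝ) : 0 < 1 + x ^ 2 := by positivity

lemma hasDeriv_c (x : ℝ) : HasDerivAt (fun x => √(1 + x ^ 2)) (x / √(1 + x ^ 2)) x := by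
  have h : HasDerivAt (fun x : ℝ => 1 + x ^ 2) (2 * x) x := by
    simpa using ((hasDerivAt_id x).pow 2).const_add 1
  refine (h.sqrt (cpos x).ne').congr_deriv ?_
  field_simp

lemma hasDeriv_gz (t x : ℝ) : HasDerivAt (gz t) (gf t x) x := by
  have hc := Real.sqrt_pos.2 (cpos x)
  have h2 := Real.sq_sqrt (cpos x).le
  have h := (((hasDerivAt_arsinh x).const_mul (2 * t)).cos).div (hasDeriv_c x) hc.ne'
  refine h.congr_deriv ?_
  simp only [gf, gz]
  rw [← h2]
  generalize √(1 + x ^ 2) = c at *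
  rw [Real.sqrt_sq hc.le]
  field_simp

lemma hasDeriv_gf (t x : ℝ) : HasDerivAt (gf t) (gs t x) x := by
  have hc := Real.sqrt_pos.2 (cpos x)
  have h2 := Real.sq_sqrt (cpos x).le
  have hq : HasDerivAt (fun x : ℝ => 1 + x ^ 2) (2 * x) x := by
    simpa using ((hasDerivAt_id x).pow 2).const_add 1
  have h := ((((((hasDerivAt_arsinh x).const_mul (2 * t)).sin).const_mul (2 * t)).neg).div hq
    (cpos x).ne').sub (((hasDerivAt_id x).mul (hasDeriv_gz t x)).div hq (cpos x).ne')
  refine h.congr_deriv ?_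
  simp only [gs, gf, gz, id, Pi.neg_apply, Pi.mul_apply]
  have h3 : x ^ 2 = √(1 + x ^ 2) ^ 2 - 1 := by linarith
  generalize √(1 + x ^ 2) = c at *
  have h4 : 1 + x ^ 2 = c ^ 2 := h2.symm
  rw [h4]
  field_simp
  ring_nf
  try simp only [h3]
  try ring_nf

lemma cont_gz (t : ℝ) : Continuous (gz t) :=
  continuous_iff_continuousAt.2 fun x => (hasDeriv_gz t x).continuousAt
lemma cont_gf (t : ℝ) : Continuous (gf t) :=
  continuous_iff_continuousAt.2 fun x => (hasDeriv_gf t x).continuousAt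
lemma cont_gs (t : ℝ) : Continuous (gs t) := by
  unfold gs
  refine Continuous.div ?_ (by fun_prop) (fun x => (cpos x).ne')
  have := cont_gz t
  have := cont_gf t
  fun_prop

def Hz (t s : ℝ) : ℝ := ∫ p in (0:ℝ)..(π / 2), gz t (s * sin p)
def Hf (t s : ℝ) : ℝ := ∫ p in (0:ℝ)..(π / 2), sin p * gf t (s * sin p)
def Hs (t s : ℝ) : ℝ := ∫ p in (0:ℝ)..(π / 2), sin p * sin p * gs t (s * sin p)

lemma hasDeriv_Hz (t s : ℝ) : HasDerivAt (Hz t) (Hf t s) s := by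
  have h := param_deriv (fun _ => 1) (gz t) (gf t) continuous_const (hasDeriv_gz t) (cont_gf t) s
  simp only [one_mul] at h
  exact h

lemma hasDeriv_Hf (t s : ℝ) : HasDerivAt (Hf t) (Hs t s) s :=
  param_deriv sin (gf t) (gs t) continuous_sin (hasDeriv_gf t) (cont_gs t) s

/-- The differential equation. -/
lemma ode_s19 (t s : ℝ) :
    s * (1 + s ^ 2) * Hs t s + (1 + 3 * s ^ 2) * Hf t s = -(1 + 4 * t ^ 2) * s * Hz t s := by
  have c0 := cont_gz t
  have c1 := cont_gf t
  have c2 := cont_gs t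
  have key : ∫ p in (0:ℝ)..(π / 2), (sin p * gf t (s * sin p)
      - s * cos p ^ 2 * gs t (s * sin p)) = 0 := by
    have hd : ∀ p ∈ uIcc (0:ℝ) (π / 2), HasDerivAt (fun p => -(cos p * gf t (s * sin p)))
        (sin p * gf t (s * sin p) - s * cos p ^ 2 * gs t (s * sin p)) p := by
      intro p _
      have h := ((hasDerivAt_cos p).mul
        ((hasDeriv_gf t (s * sin p)).comp p ((hasDerivAt_sin p).const_mul s))).neg
      refine h.congr_deriv ?_
      simp only [Function.comp]
      ring
    rw [intervalIntegral.integral_eq_sub_of_hasDerivAt hd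
      ((by fun_prop : Continuous _).intervalIntegrable _ _)]
    simp [gf]
  have e0 : IntervalIntegrable (fun p => gz t (s * sin p)) volume 0 (π / 2) :=
    (by fun_prop : Continuous _).intervalIntegrable _ _
  have e1 : IntervalIntegrable (fun p => sin p * gf t (s * sin p)) volume 0 (π / 2) :=
    (by fun_prop : Continuous _).intervalIntegrable _ _
  have e2 : IntervalIntegrable (fun p => sin p * sin p * gs t (s * sin p)) volume 0 (π / 2) :=
    (by fun_prop : Continuous _).intervalIntegrable _ _
  suffices h : s * (1 + s ^ 2) * Hs t s + (1 + 3 * s ^ 2) * Hf t s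
      + (1 + 4 * t ^ 2) * s * Hz t s = 0 by linarith
  rw [← key]
  unfold Hs Hf Hz
  rw [← intervalIntegral.integral_const_mul, ← intervalIntegral.integral_const_mul,
    ← intervalIntegral.integral_const_mul, ← intervalIntegral.integral_add
      (e2.const_mul _) (e1.const_mul _), ← intervalIntegral.integral_add
      ((e2.const_mul _).add (e1.const_mul _)) (e0.const_mul _)]
  refine intervalIntegral.integral_congr fun p _ => ?_
  have hg : (1 + (s * sin p) ^ 2) * gs t (s * sin p)
      = -(3 * (s * sin p) * gf t (s * sin p) + (1 + 4 * t ^ 2) * gz t (s * sin p)) := by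
    unfold gs
    have := (cpos (s * sin p)).ne'
    field_simp
  have hcs := sin_sq_add_cos_sq p
  linear_combination s * hg + (s * gs t (s * sin p)) * hcs

def Kf (t s : ℝ) : ℝ := s * (1 + s ^ 2) * Hf t s

lemma hasDeriv_Kf (t s : ℝ) : HasDerivAt (Kf t) (-(1 + 4 * t ^ 2) * s * Hz t s) s := by
  have hq : HasDerivAt (fun x : ℝ => 1 + x ^ 2) (2 * s) s := by
    simpa using ((hasDerivAt_id s).pow 2).const_add 1
  have h := ((hasDerivAt_id s).mul hq).mul (hasDeriv_Hf t s)
  refine h.congr_deriv ?_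
  rw [← ode_s19]
  simp
  ring

lemma arsinh_le_self {s : ℝ} (hs : 0 ≤ s) : arsinh s ≤ s := by
  have := Real.self_le_sinh_iff.2 (arsinh_nonneg_iff.2 hs)
  rwa [sinh_arsinh] at this

lemma Hz_bound (t s : ℝ) (hs : 0 ≤ s) : s * |Hz t s| ≤ π / 2 * arsinh s := by
  rcases hs.eq_or_lt with rfl | hs
  · simp
  have hpi := Real.pi_pos
  have h1 : |Hz t s| ≤ ∫ p in (0:ℝ)..(π / 2), (√(1 + (s * (2 / π * p)) ^ 2))⁻¹ := by
    unfold Hz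
    rw [← Real.norm_eq_abs]
    refine intervalIntegral.norm_integral_le_of_norm_le (by positivity) ?_ ?_
    · refine Filter.Eventually.of_forall fun p hp => ?_
      rw [Real.norm_eq_abs]
      unfold gz
      rw [abs_div, abs_of_nonneg (Real.sqrt_nonneg _), div_eq_mul_inv]
      have h2 : (√(1 + (s * sin p) ^ 2))⁻¹ ≤ (√(1 + (s * (2 / π * p)) ^ 2))⁻¹ := by
        have := mul_le_sin hp.1.le hp.2
        have hp0 := hp.1
        apply inv_anti₀ (Real.sqrt_pos.2 (cpos _))
        gcongr
      have h3 := abs_cos_le_one (2 * t * arsinh (s * sin p))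
      have h4 : 0 ≤ (√(1 + (s * sin p) ^ 2))⁻¹ := by positivity
      nlinarith
    · refine Continuous.intervalIntegrable ?_ _ _
      exact Continuous.inv₀ (by fun_prop) (fun p => (Real.sqrt_pos.2 (cpos _)).ne')
  have h2 : ∫ p in (0:ℝ)..(π / 2), (√(1 + (s * (2 / π * p)) ^ 2))⁻¹ = π / (2 * s) * arsinh s := by
    have hd : ∀ p ∈ uIcc (0:ℝ) (π / 2), HasDerivAt
        (fun p => π / (2 * s) * arsinh (s * (2 / π * p))) (√(1 + (s * (2 / π * p)) ^ 2))⁻¹ p := by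
      intro p _
      have h := (((((hasDerivAt_id p).const_mul (2 / π)).const_mul s).arsinh)).const_mul
        (π / (2 * s))
      refine h.congr_deriv ?_
      have := (Real.sqrt_pos.2 (cpos (s * (2 / π * p)))).ne'
      simp only [id, smul_eq_mul]
      field_simp
    rw [intervalIntegral.integral_eq_sub_of_hasDerivAt hd]
    · have : s * (2 / π * (π / 2)) = s := by field_simp
      simp
    · refine Continuous.intervalIntegrable ?_ _ _
      exact Continuous.inv₀ (by fun_prop) (fun p => (Real.sqrt_pos.2 (cpos _)).ne')
  rw [h2] at h1
  calc s * |Hz t s| ≤ s * (π / (2 * s) * arsinh s) := by gcongr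
    _ = _ := by field_simp

lemma Kf_bound (t s : ℝ) (hs : 0 ≤ s) :
    |Kf t s| ≤ (1 + 4 * t ^ 2) * (π / 2) * arsinh s * s := by
  have h := norm_image_sub_le_of_norm_deriv_le_segment' (f := Kf t) (a := 0) (b := s)
    (C := (1 + 4 * t ^ 2) * (π / 2) * arsinh s)
    (fun x _ => (hasDeriv_Kf t x).hasDerivWithinAt) (by
      intro x hx
      have h1 := Hz_bound t x hx.1
      have h2 := arsinh_le_arsinh.2 hx.2.le
      rw [Real.norm_eq_abs, abs_mul, abs_mul, abs_neg, abs_of_nonneg hx.1,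
        abs_of_nonneg (by positivity : 0 ≤ 1 + 4 * t ^ 2), mul_assoc, mul_assoc]
      have hpi := Real.pi_pos
      refine mul_le_mul_of_nonneg_left (h1.trans ?_) (by positivity)
      gcongr) s (right_mem_Icc.2 hs)
  simpa [Kf] using h

lemma theta_eq {u : ℝ} (hu : 0 ≤ u) : acosh (2 * u + 1) = 2 * arsinh (√u) := by
  have h0 := Real.sq_sqrt hu
  have hs := Real.sqrt_nonneg u
  have h1 : exp (2 * arsinh (√u)) = 2 * u + 1 + √((2 * u + 1) ^ 2 - 1) := by
    have : (2 * u + 1) ^ 2 - 1 = (2 * √u * √(1 + √u ^ 2)) ^ 2 := by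
      rw [mul_pow, mul_pow, Real.sq_sqrt (cpos _).le, h0]; ring
    rw [this, Real.sqrt_sq (by positivity), two_mul (arsinh _), Real.exp_add, exp_arsinh]
    have h2 := Real.sq_sqrt (cpos (√u)).le
    nlinarith
  unfold acosh
  rw [← h1, Real.log_exp]

lemma cosh_two_arsinh (x : ℝ) : cosh (2 * arsinh x) = 1 + 2 * x ^ 2 := by
  rw [Real.cosh_two_mul, cosh_arsinh, sinh_arsinh, Real.sq_sqrt (cpos x).le]; ring

lemma Xi_eq (t : ℝ) {u : ℝ} (hu : 0 < u) : XiFun t u = √2 / π * Hz t (√u) := by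
  have hpi := Real.pi_pos
  have h0 := Real.sq_sqrt hu.le
  have hs := Real.sqrt_pos.2 hu
  unfold XiFun
  rw [theta_eq hu.le]
  congr 1
  generalize √u = s at *
  have him : Set.image (fun p => 2 * arsinh (s * sin p)) (Ioo 0 (π / 2)) = Ioo 0 (2 * arsinh s) := by
    ext a
    constructor
    · rintro ⟨p, ⟨hp0, hp1⟩, rfl⟩
      have hsin : 0 < sin p := sin_pos_of_pos_of_lt_pi hp0 (by linarith)
      have hsin1 : sin p < 1 := by
        rw [← sin_pi_div_two]
        exact sin_lt_sin_of_lt_of_le_pi_div_two (by linarith) le_rfl hp1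
      have h1 : 0 < arsinh (s * sin p) := arsinh_pos_iff.2 (by positivity)
      have h2 : arsinh (s * sin p) < arsinh s := arsinh_lt_arsinh.2 (by nlinarith)
      constructor <;> simp only <;> linarith
    · rintro ⟨ha0, ha1⟩
      have h1 : 0 < sinh (a / 2) := sinh_pos_iff.2 (by linarith)
      have h2 : sinh (a / 2) < s := by
        rw [← sinh_arsinh s]
        exact sinh_lt_sinh.2 (by linarith)
      have h3 : 0 < sinh (a / 2) / s := by positivity
      have h4 : sinh (a / 2) / s < 1 := by rwa [div_lt_one hs]
      refine ⟨arcsin (sinh (a / 2) / s), ⟨arcsin_pos.2 h3, arcsin_lt_pi_div_two.2 h4⟩, ?_⟩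
      simp only
      rw [sin_arcsin (by linarith) h4.le, mul_div_cancel₀ _ hs.ne', arsinh_sinh]
      ring
  have hinj : InjOn (fun p => 2 * arsinh (s * sin p)) (Ioo 0 (π / 2)) := by
    intro p hp q hq h
    have h1 : arsinh (s * sin p) = arsinh (s * sin q) := by simpa using h
    have h2 := mul_left_cancel₀ hs.ne' (arsinh_injective h1)
    exact injOn_sin ⟨by linarith [hp.1], hp.2.le⟩ ⟨by linarith [hq.1], hq.2.le⟩ h2
  have hder : ∀ p ∈ Ioo 0 (π / 2), HasDerivWithinAt (fun p => 2 * arsinh (s * sin p))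
      (2 * ((√(1 + (s * sin p) ^ 2))⁻¹ * (s * cos p))) (Ioo 0 (π / 2)) p := by
    intro p _
    exact ((((hasDerivAt_sin p).const_mul s).arsinh).const_mul 2).hasDerivWithinAt
  rw [← him, integral_image_eq_integral_abs_deriv_smul measurableSet_Ioo hder hinj]
  unfold Hz
  rw [intervalIntegral.integral_of_le (by positivity), integral_Ioc_eq_integral_Ioo]
  refine setIntegral_congr_fun measurableSet_Ioo fun p hp => ?_
  have hcos : 0 < cos p := cos_pos_of_mem_Ioo ⟨by linarith [hp.1], hp.2⟩
  have hcs := sin_sq_add_cos_sq p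
  have hsq : 2 * (cosh (2 * arsinh s) - cosh (2 * arsinh (s * sin p))) = (2 * (s * cos p)) ^ 2 := by
    rw [cosh_two_arsinh, cosh_two_arsinh]
    linear_combination (-4 * s ^ 2) * hcs
  have hc := Real.sqrt_pos.2 (cpos (s * sin p))
  rw [hsq, Real.sqrt_sq (by positivity), abs_of_nonneg (by positivity), smul_eq_mul]
  unfold gz
  rw [show t * (2 * arsinh (s * sin p)) = 2 * t * arsinh (s * sin p) by ring]
  field_simp

lemma Xi_deriv (t : ℝ) {u : ℝ} (hu : 0 < u) :
    HasDerivAt (XiFun t) (√2 / π * (Kf t (√u) / (2 * u * (1 + u)))) u := by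
  have h0 := Real.sq_sqrt hu.le
  have hs := Real.sqrt_pos.2 hu
  have h := ((hasDeriv_Hz t (√u)).comp u (Real.hasDerivAt_sqrt hu.ne')).const_mul (√2 / π)
  have h' := h.congr_of_eventuallyEq (f₁ := XiFun t) (by
    filter_upwards [lt_mem_nhds hu] with v hv
    exact Xi_eq t hv)
  refine h'.congr_deriv ?_
  congr 1
  unfold Kf
  have : 0 < 1 + u := by linarith
  rw [h0]
  field_simp
  try rw [h0]

lemma Xi_deriv2 (t : ℝ) {u : ℝ} (hu : 0 < u) :
    HasDerivAt (deriv (XiFun t)) (√2 / π * (-(1 + 4 * t ^ 2) * Hz t (√u) / (4 * u * (1 + u))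
      - Kf t (√u) * (2 + 4 * u) / (2 * u * (1 + u)) ^ 2)) u := by
  have h0 := Real.sq_sqrt hu.le
  have hs := Real.sqrt_pos.2 hu
  have hq : HasDerivAt (fun u : ℝ => 2 * u * (1 + u)) (2 + 4 * u) u := by
    refine (((hasDerivAt_id u).const_mul 2).mul ((hasDerivAt_id u).const_add 1)).congr_deriv ?_
    simp; ring
  have h := ((((hasDeriv_Kf t (√u)).comp u (Real.hasDerivAt_sqrt hu.ne'))).div hq
    (by positivity)).const_mul (√2 / π)
  have h' := h.congr_of_eventuallyEq (f₁ := deriv (XiFun t)) (by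
    filter_upwards [lt_mem_nhds hu] with v hv
    exact (Xi_deriv t hv).deriv)
  refine h'.congr_deriv ?_
  congr 1
  simp only [Function.comp]
  field_simp
  try ring

lemma const_le : √2 / π * (π / 2) ≤ 1 := by
  have hpi := Real.pi_pos
  have : √2 ≤ 2 := by
    rw [Real.sqrt_le_left (by norm_num)]; norm_num
  have h : √2 / π * (π / 2) = √2 / 2 := by field_simp
  rw [h]; linarith

lemma bound0 (t : ℝ) {u : ℝ} (hu : 0 < u) : |XiFun t u| ≤ arsinh (√u) / √u := by
  have hs := Real.sqrt_pos.2 hu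
  have hpi := Real.pi_pos
  have hM : 0 ≤ arsinh (√u) := arsinh_nonneg_iff.2 hs.le
  rw [Xi_eq t hu, abs_mul, abs_of_nonneg (by positivity : 0 ≤ √2 / π), le_div_iff₀ hs]
  calc √2 / π * |Hz t (√u)| * √u = √2 / π * (√u * |Hz t (√u)|) := by ring
    _ ≤ √2 / π * (π / 2 * arsinh (√u)) := 
        mul_le_mul_of_nonneg_left (Hz_bound t _ hs.le) (by positivity)
    _ = (√2 / π * (π / 2)) * arsinh (√u) := by ring
    _ ≤ 1 * arsinh (√u) := by gcongr; exact const_le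
    _ = _ := one_mul _

lemma bound1 (t : ℝ) {u : ℝ} (hu : 0 < u) :
    |deriv (XiFun t) u| ≤ (1 + 4 * t ^ 2) / 2 * (arsinh (√u) / (√u * (1 + u))) := by
  have h0 := Real.sq_sqrt hu.le
  have hs := Real.sqrt_pos.2 hu
  have hpi := Real.pi_pos
  have hM : 0 ≤ arsinh (√u) := arsinh_nonneg_iff.2 hs.le
  rw [(Xi_deriv t hu).deriv, abs_mul, abs_of_nonneg (by positivity : 0 ≤ √2 / π), abs_div,
    abs_of_nonneg (by positivity : 0 ≤ 2 * u * (1 + u))]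
  calc √2 / π * (|Kf t (√u)| / (2 * u * (1 + u)))
      ≤ √2 / π * (((1 + 4 * t ^ 2) * (π / 2) * arsinh (√u) * √u) / (2 * u * (1 + u))) := by
        gcongr; exact Kf_bound t _ hs.le
    _ = (√2 / π * (π / 2)) * (((1 + 4 * t ^ 2) * arsinh (√u) * √u) / (2 * u * (1 + u))) := by ring
    _ ≤ 1 * (((1 + 4 * t ^ 2) * arsinh (√u) * √u) / (2 * u * (1 + u))) := by
        gcongr; exact const_le
    _ = _ := by
        generalize √u = s at *
        subst h0
        have := cpos s
        field_simp

lemma bound2 (t : ℝ) {u : ℝ} (hu : 0 < u) :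
    |deriv (deriv (XiFun t)) u| ≤ 5 / 4 * (1 + 4 * t ^ 2) * (arsinh (√u) / (√u * u * (1 + u))) := by
  have h0 := Real.sq_sqrt hu.le
  have hs := Real.sqrt_pos.2 hu
  have hpi := Real.pi_pos
  have hM : 0 ≤ arsinh (√u) := arsinh_nonneg_iff.2 hs.le
  have hH : |Hz t (√u)| ≤ π / 2 * arsinh (√u) / √u := by
    rw [le_div_iff₀ hs, mul_comm]; exact Hz_bound t _ hs.le
  have hT : 0 < 1 + 4 * t ^ 2 := by positivity
  rw [(Xi_deriv2 t hu).deriv, abs_mul, abs_of_nonneg (by positivity : 0 ≤ √2 / π)]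
  have hA : |-(1 + 4 * t ^ 2) * Hz t (√u) / (4 * u * (1 + u))
      - Kf t (√u) * (2 + 4 * u) / (2 * u * (1 + u)) ^ 2| ≤
      (1 + 4 * t ^ 2) * (π / 2 * arsinh (√u) / √u) / (4 * u * (1 + u))
      + ((1 + 4 * t ^ 2) * (π / 2) * arsinh (√u) * √u) * (4 * (1 + u))
        / (2 * u * (1 + u)) ^ 2 := by
    refine (abs_sub _ _).trans (add_le_add ?_ ?_)
    · rw [abs_div, abs_mul, abs_neg, abs_of_nonneg hT.le,
        abs_of_nonneg (by positivity : 0 ≤ 4 * u * (1 + u))]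
      gcongr
    · rw [abs_div, abs_mul, abs_of_nonneg (by positivity : 0 ≤ 2 + 4 * u),
        abs_of_nonneg (by positivity : 0 ≤ (2 * u * (1 + u)) ^ 2)]
      gcongr
      · exact Kf_bound t _ hs.le
      · linarith
  calc _ ≤ √2 / π * _ := mul_le_mul_of_nonneg_left hA (by positivity)
    _ = (√2 / π * (π / 2)) * (5 / 4 * (1 + 4 * t ^ 2) * (arsinh (√u) / (√u * u * (1 + u)))) := by
        generalize √u = s at *
        subst h0
        have := cpos s
        field_simp
        try ring
    _ ≤ 1 * (5 / 4 * (1 + 4 * t ^ 2) * (arsinh (√u) / (√u * u * (1 + u)))) := by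
        gcongr; exact const_le
    _ = _ := one_mul _

lemma arsinh_le_log {u : ℝ} (hu : 2 ≤ u) : arsinh (√u) ≤ 2 * Real.log u := by
  have h0 := Real.sq_sqrt (by linarith : 0 ≤ u)
  have h1 : √u ≤ u := by rw [Real.sqrt_le_left (by linarith)]; nlinarith
  have h2 : √(1 + √u ^ 2) ≤ u := by rw [h0, Real.sqrt_le_left (by linarith)]; nlinarith
  have hs := Real.sqrt_pos.2 (by linarith : 0 < u)
  have h3 : 2 * Real.log u = Real.log (u ^ 2) := by rw [Real.log_pow]; norm_num
  rw [h3, arsinh]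
  apply Real.log_le_log (by positivity)
  nlinarith

lemma rpow_a {u : ℝ} (hu : 0 < u) : u ^ (-(1 : ℝ) / 2) = (√u)⁻¹ := by
  rw [neg_div, Real.rpow_neg hu.le, Real.sqrt_eq_rpow]
lemma rpow_b {u : ℝ} (hu : 0 < u) : u ^ (-(3 : ℝ) / 2) = (√u * u)⁻¹ := by
  rw [show -(3 : ℝ) / 2 = -(1 : ℝ) / 2 - 1 by norm_num, Real.rpow_sub_one hu.ne', rpow_a hu]
  field_simp
lemma rpow_c {u : ℝ} (hu : 0 < u) : u ^ (-(5 : ℝ) / 2) = (√u * u * u)⁻¹ := by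
  rw [show -(5 : ℝ) / 2 = -(3 : ℝ) / 2 - 1 by norm_num, Real.rpow_sub_one hu.ne', rpow_b hu]
  field_simp

/-- Bounds for the spherical function Ξ_t and its first two derivatives. -/
theorem stmt19 : ∃ C : ℝ, 0 < C ∧
    ∀ t : ℝ,
    (∀ u : ℝ, 0 < u →
      DifferentiableAt ℝ (XiFun t) u ∧ DifferentiableAt ℝ (deriv (XiFun t)) u) ∧
    (∀ u : ℝ, 0 ≤ u → u ≤ 2 → |XiFun t u| ≤ C) ∧
    (∀ u : ℝ, 2 ≤ u → |XiFun t u| ≤ C * Real.log u * u ^ (-(1 : ℝ) / 2)) ∧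
    (∀ u : ℝ, 0 < u → u ≤ 2 → |deriv (XiFun t) u| ≤ C * (1 + t ^ 2)) ∧
    (∀ u : ℝ, 2 ≤ u →
      |deriv (XiFun t) u| ≤ C * (1 + t ^ 2) * Real.log u * u ^ (-(3 : ℝ) / 2)) ∧
    (∀ u : ℝ, 0 < u → u ≤ 2 → |deriv (deriv (XiFun t)) u| ≤ C * (1 + t ^ 2) * u⁻¹) ∧
    (∀ u : ℝ, 2 ≤ u →
      |deriv (deriv (XiFun t)) u| ≤ C * (1 + t ^ 2) * Real.log u * u ^ (-(5 : ℝ) / 2)) := by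
  refine ⟨10, by norm_num, fun t => ⟨fun u hu => ⟨(Xi_deriv t hu).differentiableAt,
    (Xi_deriv2 t hu).differentiableAt⟩, ?_, ?_, ?_, ?_, ?_, ?_⟩⟩
  · intro u hu _
    rcases hu.eq_or_lt with rfl | hu
    · simp [XiFun, acosh]
    · have hs := Real.sqrt_pos.2 hu
      have h2 : arsinh (√u) / √u ≤ 1 := by
        rw [div_le_one hs]; exact arsinh_le_self hs.le
      linarith [bound0 t hu]
  · intro u hu2
    have hu : 0 < u := by linarith
    have hs := Real.sqrt_pos.2 hu
    have hl := Real.log_pos (by linarith : 1 < u)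
    have hM := arsinh_le_log hu2
    refine (bound0 t hu).trans ?_
    rw [rpow_a hu, ← div_eq_mul_inv]
    gcongr
    linarith
  · intro u hu _
    have hs := Real.sqrt_pos.2 hu
    have hM := arsinh_le_self hs.le
    refine (bound1 t hu).trans ?_
    have h2 : arsinh (√u) / (√u * (1 + u)) ≤ 1 := by
      rw [div_le_one (by positivity)]
      nlinarith
    have hT : 0 < 1 + 4 * t ^ 2 := by positivity
    nlinarith [sq_nonneg t]
  · intro u hu2
    have hu : 0 < u := by linarith
    have hs := Real.sqrt_pos.2 hu
    have hl := Real.log_pos (by linarith : 1 < u)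
    have hM := arsinh_le_log hu2
    refine (bound1 t hu).trans ?_
    rw [rpow_b hu]
    calc (1 + 4 * t ^ 2) / 2 * (arsinh (√u) / (√u * (1 + u)))
        ≤ (5 * (1 + t ^ 2)) * ((2 * Real.log u) / (√u * u)) := by
          have hA : 0 ≤ arsinh (√u) := arsinh_nonneg_iff.2 hs.le
          refine mul_le_mul (by nlinarith [sq_nonneg t]) ?_ (by positivity) (by positivity)
          gcongr
          linarith
      _ = _ := by ring
  · intro u hu _
    have hs := Real.sqrt_pos.2 hu
    have hM := arsinh_le_self hs.le
    refine (bound2 t hu).trans ?_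
    calc 5 / 4 * (1 + 4 * t ^ 2) * (arsinh (√u) / (√u * u * (1 + u)))
        ≤ (10 * (1 + t ^ 2)) * (√u / (√u * u * 1)) := by
          have hA : 0 ≤ arsinh (√u) := arsinh_nonneg_iff.2 hs.le
          refine mul_le_mul (by nlinarith [sq_nonneg t]) ?_ (by positivity) (by positivity)
          gcongr
          linarith
      _ = _ := by field_simp
  · intro u hu2
    have hu : 0 < u := by linarith
    have hs := Real.sqrt_pos.2 hu
    have hl := Real.log_pos (by linarith : 1 < u)
    have hM := arsinh_le_log hu2
    refine (bound2 t hu).trans ?_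
    rw [rpow_c hu]
    calc 5 / 4 * (1 + 4 * t ^ 2) * (arsinh (√u) / (√u * u * (1 + u)))
        ≤ (5 * (1 + t ^ 2)) * ((2 * Real.log u) / (√u * u * u)) := by
          have hA : 0 ≤ arsinh (√u) := arsinh_nonneg_iff.2 hs.le
          refine mul_le_mul (by nlinarith [sq_nonneg t]) ?_ (by positivity) (by positivity)
          gcongr
          linarith
      _ = _ := by ring
end
end
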